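/- Let Z : [0,T] × ℝ → ℝ satisfy sup_t TV(Z(t,·)) =: |Z|_{L^∞_t BV_x} < ∞, let z ∈ L^1([0,T] × ℝ) ∩ L^∞([0,T] × ℝ), and let ω_η be a nonnegative kernel supported in [-η, 0] (or [0,η]) with ∫ ω_η = 1 and ‖z‖_{L^∞} ≤ 1. Then ∫_0^T ∫_ℝ |((Zz) * ω_η)(t,x) - Z(t,x)(z * ω_η)(t,x)| dx dt ≤ η T |Z|_{L^∞_t BV_x}, where * denotes convolution in the spatial variable. -/

import Mathlib

open MeasureTheory

/-- The `L¹` modulus of continuity of a bounded monotone function. -/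
lemma lintegral_monotone_sub_translate_le {w : ℝ → ℝ} (hw : Monotone w) {B : ℝ}
    (h0 : ∀ x, 0 ≤ w x) (h1 : ∀ x, w x ≤ B) {s : ℝ} (hs : 0 ≤ s) :
    ∫⁻ x, ENNReal.ofReal (w x - w (x - s)) ≤ ENNReal.ofReal (s * B) := by
  have hint : ∀ a b, IntervalIntegrable w volume a b := fun a b => hw.intervalIntegrable
  have hw' : Monotone fun x => w (x - s) := fun x y hxy => hw (by linarith)
  have hcov : AECover (volume : Measure ℝ) Filter.atTop (fun n : ℕ => Set.Ioc (-(n : ℝ)) n) :=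
    aecover_Ioc (Filter.tendsto_neg_atTop_atBot.comp tendsto_natCast_atTop_atTop)
      tendsto_natCast_atTop_atTop
  refine le_of_tendsto' (hcov.lintegral_tendsto_of_countably_generated
    (hw.measurable.sub hw'.measurable).ennreal_ofReal.aemeasurable) fun n => ?_
  have hn : -(n : ℝ) ≤ n := by have := n.cast_nonneg (α := ℝ); linarith
  have hsub : IntervalIntegrable (fun x => w x - w (x - s)) volume (-(n : ℝ)) n :=
    hw.intervalIntegrable.sub hw'.intervalIntegrable
  rw [← ofReal_integral_eq_lintegral_ofReal
    ((intervalIntegrable_iff_integrableOn_Ioc_of_le hn).1 hsub)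
    (Filter.Eventually.of_forall fun x => sub_nonneg.2 (hw (by linarith)))]
  refine ENNReal.ofReal_le_ofReal ?_
  rw [← intervalIntegral.integral_of_le hn,
    intervalIntegral.integral_sub hw.intervalIntegrable hw'.intervalIntegrable,
    intervalIntegral.integral_comp_sub_right w s,
    intervalIntegral.integral_interval_sub_interval_comm (hint _ _) (hint _ _) (hint _ _),
    intervalIntegral.integral_symm]
  have hlow : 0 ≤ ∫ x in (-(n : ℝ) - s)..(-(n : ℝ)), w x :=
    intervalIntegral.integral_nonneg (by linarith) fun x _ => h0 x
  have hup : ∫ x in ((n : ℝ) - s)..(n : ℝ), w x ≤ s * B := by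
    have := intervalIntegral.integral_mono_on (a := (n : ℝ) - s) (b := n) (by linarith)
      (hint _ _) (intervalIntegrable_const (c := B)) fun x _ => h1 x
    simpa using this
  have hsymm := intervalIntegral.integral_symm (μ := volume) (f := w) ((n : ℝ) - s) n
  linarith

/-- The `L¹` modulus of continuity of a function of bounded variation on the line. -/
lemma lintegral_enorm_sub_translate_le {f : ℝ → ℝ} {B : ℝ} (hB : 0 ≤ B)
    (hf : eVariationOn f Set.univ ≤ ENNReal.ofReal B) {s : ℝ} (hs : 0 ≤ s) :
    ∫⁻ x, ‖f (x - s) - f x‖ₑ ≤ ENNReal.ofReal (s * B) := by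
  have hle : ∀ x, eVariationOn f (Set.Iic x) ≤ ENNReal.ofReal B := fun x =>
    (eVariationOn.mono f (Set.subset_univ _)).trans hf
  have hfin : ∀ x, eVariationOn f (Set.Iic x) ≠ ⊤ := fun x =>
    ((hle x).trans_lt ENNReal.ofReal_lt_top).ne
  have hmono : Monotone fun x => (eVariationOn f (Set.Iic x)).toReal := fun x y hxy =>
    ENNReal.toReal_mono (hfin y) (eVariationOn.mono f (Set.Iic_subset_Iic.2 hxy))
  refine le_trans (lintegral_mono fun x => ?_) (lintegral_monotone_sub_translate_le hmono
    (fun _ => ENNReal.toReal_nonneg) (fun x => ENNReal.toReal_le_of_le_ofReal hB (hle x)) hs)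
  have hadd : eVariationOn f (Set.Iic (x - s)) + eVariationOn f (Set.Icc (x - s) x) ≤
      eVariationOn f (Set.Iic x) :=
    (eVariationOn.add_le_union f fun a ha b hb => le_trans ha hb.1).trans
      (eVariationOn.mono f (Set.union_subset (Set.Iic_subset_Iic.2 (by linarith))
        fun _ h => h.2))
  have hed : ‖f (x - s) - f x‖ₑ ≤ eVariationOn f (Set.Icc (x - s) x) := by
    rw [← edist_eq_enorm_sub]
    exact eVariationOn.edist_le f ⟨le_rfl, by linarith⟩ ⟨by linarith, le_rfl⟩
  rw [ENNReal.ofReal_sub _ ENNReal.toReal_nonneg, ENNReal.ofReal_toReal (hfin _),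
    ENNReal.ofReal_toReal (hfin _)]
  exact ENNReal.le_sub_of_add_le_left (hfin _) ((add_le_add_right hed _).trans hadd)

/-- The commutator estimate for functions of the space variable alone. -/
lemma integral_abs_commutator_le {η B : ℝ} (hη : 0 < η) (hB : 0 ≤ B) {f g ω : ℝ → ℝ}
    (hf : eVariationOn f Set.univ ≤ ENNReal.ofReal B) (hg : Measurable g)
    (hg1 : ∀ x, |g x| ≤ 1) (hω_nonneg : ∀ x, 0 ≤ ω x)
    (hω_supp : ∀ x, x ∉ Set.Icc 0 η → ω x = 0) (hω_mass : (∫ x, ω x) = 1) :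
    ‖∫ x : ℝ, |(∫ y : ℝ, f y * g y * ω (x - y)) - f x * ∫ y : ℝ, g y * ω (x - y)|‖ ≤
      η * B := by
  have hfin : BoundedVariationOn f Set.univ := (hf.trans_lt ENNReal.ofReal_lt_top).ne
  have hfm : Measurable f := by
    obtain ⟨p, q, hp, hq, rfl⟩ :=
      hfin.locallyBoundedVariationOn.exists_monotoneOn_sub_monotoneOn
    exact (monotoneOn_univ.1 hp).measurable.sub (monotoneOn_univ.1 hq).measurable
  have hfb : ∀ x, ‖f x‖ ≤ |f 0| + B := fun x => by
    have h := (eVariationOn.edist_le f (Set.mem_univ x) (Set.mem_univ 0)).trans hf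
    rw [edist_dist, ENNReal.ofReal_le_ofReal_iff hB, Real.dist_eq] at h
    rw [Real.norm_eq_abs]
    linarith [abs_sub_abs_le_abs_sub (f x) (f 0)]
  have hω : Integrable ω := by
    by_contra h
    simp [integral_undef h] at hω_mass
  have hgω : ∀ x, Integrable fun y => g y * ω (x - y) := fun x =>
    (hω.comp_sub_left x).bdd_mul hg.aestronglyMeasurable
      (Filter.Eventually.of_forall hg1)
  have hfgω : ∀ x, Integrable fun y => f y * (g y * ω (x - y)) := fun x =>
    (hgω x).bdd_mul hfm.aestronglyMeasurable (Filter.Eventually.of_forall hfb)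
  have hpt : ∀ x, ENNReal.ofReal
      ‖|(∫ y : ℝ, f y * g y * ω (x - y)) - f x * ∫ y : ℝ, g y * ω (x - y)|‖ ≤
      ∫⁻ s, ‖f (x - s) - f x‖ₑ * ‖ω s‖ₑ := fun x => by
    rw [Real.norm_eq_abs, abs_abs, ← Real.norm_eq_abs, ofReal_norm,
      ← integral_const_mul]
    simp only [mul_assoc]
    rw [← integral_sub (hfgω x) ((hgω x).const_mul (f x))]
    refine (enorm_integral_le_lintegral_enorm _).trans ?_
    rw [← lintegral_sub_left_eq_self _ x]
    refine lintegral_mono fun s => ?_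
    have hgs : ‖g (x - s)‖ₑ ≤ 1 := by
      rw [← ofReal_norm]
      exact ENNReal.ofReal_le_one.2 (hg1 _)
    simp only [sub_sub_cancel]
    rw [← sub_mul, enorm_mul, enorm_mul]
    exact mul_le_mul_right (mul_le_of_le_one_left' hgs) _
  have hω_lintegral : ∫⁻ s, ‖ω s‖ₑ = 1 := by
    simp_rw [fun s => Real.enorm_of_nonneg (hω_nonneg s)]
    rw [← ofReal_integral_eq_lintegral_ofReal hω (Filter.Eventually.of_forall hω_nonneg),
      hω_mass, ENNReal.ofReal_one]
  have hω_ae : AEMeasurable (fun s => ‖ω s‖ₑ) := hω.aestronglyMeasurable.enorm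
  have hmeas : AEMeasurable
      (Function.uncurry fun x s : ℝ => ‖f (x - s) - f x‖ₑ * ‖ω s‖ₑ)
      ((volume : Measure ℝ).prod volume) := by
    have h : Measurable fun p : ℝ × ℝ => ‖f (p.1 - p.2) - f p.1‖ₑ := by fun_prop
    exact h.aemeasurable.mul hω_ae.comp_snd
  refine (norm_integral_le_lintegral_norm _).trans
    (ENNReal.toReal_le_of_le_ofReal (by positivity) ?_)
  calc _ ≤ ∫⁻ x, ∫⁻ s, ‖f (x - s) - f x‖ₑ * ‖ω s‖ₑ := lintegral_mono hpt
    _ = ∫⁻ s, ∫⁻ x, ‖f (x - s) - f x‖ₑ * ‖ω s‖ₑ := lintegral_lintegral_swap hmeas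
    _ ≤ ∫⁻ s, ENNReal.ofReal (η * B) * ‖ω s‖ₑ := lintegral_mono fun s => by
      rw [lintegral_mul_const _ (by fun_prop)]
      by_cases hs : s ∈ Set.Icc 0 η
      · refine mul_le_mul_left ((lintegral_enorm_sub_translate_le hB hf hs.1).trans ?_) _
        exact ENNReal.ofReal_le_ofReal (mul_le_mul_of_nonneg_right hs.2 hB)
      · simp [hω_supp s hs]
    _ = ENNReal.ofReal (η * B) := by
      rw [lintegral_const_mul'' _ hω_ae, hω_lintegral, mul_one]

/-- Commutator estimate used in the nonlocal-to-local limit: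
`∫_0^T ∫_ℝ |((Zz) * ω_η)(t,x) - Z(t,x)(z * ω_η)(t,x)| dx dt ≤ η T |Z|_{L^∞_t BV_x}`. -/
theorem commutator_estimate (T η B : ℝ) (hT : 0 < T) (hη : 0 < η) (hB : 0 ≤ B)
    (Z z : ℝ → ℝ → ℝ) (ω : ℝ → ℝ)
    (hZBV : ∀ t ∈ Set.Icc 0 T, eVariationOn (Z t) Set.univ ≤ ENNReal.ofReal B)
    (hz_meas : Measurable fun p : ℝ × ℝ => z p.1 p.2)
    (hz_bdd : ∀ t x, |z t x| ≤ 1)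
    (hz_int : ∀ t ∈ Set.Icc 0 T, Integrable (z t))
    (hω_nonneg : ∀ x, 0 ≤ ω x)
    (hω_supp : ∀ x, x ∉ Set.Icc 0 η → ω x = 0)
    (hω_mass : (∫ x, ω x) = 1) :
    (∫ t in (0 : ℝ)..T, ∫ x : ℝ,
        |(∫ y : ℝ, Z t y * z t y * ω (x - y)) - Z t x * ∫ y : ℝ, z t y * ω (x - y)|) ≤
      η * T * B := by
  have h := intervalIntegral.norm_integral_le_of_norm_le_const (a := 0) (b := T)
    (f := fun t => ∫ x : ℝ,
      |(∫ y : ℝ, Z t y * z t y * ω (x - y)) - Z t x * ∫ y : ℝ, z t y * ω (x - y)|)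
    (C := η * B) fun t ht => by
      rw [Set.uIoc_of_le hT.le] at ht
      exact integral_abs_commutator_le hη hB (hZBV t ⟨ht.1.le, ht.2⟩)
        (hz_meas.comp measurable_prodMk_left) (hz_bdd t) hω_nonneg hω_supp hω_mass
  rw [sub_zero, abs_of_pos hT] at h
  linarith [(Real.le_norm_self _).trans h]
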